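/- arXiv:1709.00483 — 6 statements merged into one kernel-verified Lean document; each statement's English description precedes it below -/
import Mathlib

section
/- Let f : ℝ^M → ℝ be differentiable with L_f-Lipschitz gradient, let A be a real r×M matrix, and let θ > 0 satisfy ‖Aᵀu‖₂ ≥ θ‖u‖₂ for every u in the column space of A. If x, x' ∈ ℝ^M and p, p' ∈ ℝ^r satisfy Aᵀp = −∇f(x), Aᵀp' = −∇f(x'), and p − p' lies in the column space of A, then ‖p − p'‖₂ ≤ (L_f/θ)‖x − x'‖₂, and hence ‖p − p'‖₂² ≤ (L_f²/θ²)‖x − x'‖₂². -/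
open Matrix Filter Topology RealInnerProductSpace

/-- `A` acting on a Euclidean vector. -/
noncomputable def matVec {r n : ℕ} (A : Matrix (Fin r) (Fin n) ℝ)
    (x : EuclideanSpace ℝ (Fin n)) : EuclideanSpace ℝ (Fin r) :=
  Matrix.toEuclideanLin A x

/-- If `f` has an `L_f`-Lipschitz gradient, `θ > 0` bounds `‖Aᵀu‖ ≥ θ‖u‖`
on the column space of `A`, `Aᵀp = -∇f(x)`, `Aᵀp' = -∇f(x')`, and `p - p'` lies in the
column space of `A`, then `‖p - p'‖ ≤ (L_f/θ)‖x - x'‖` and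
`‖p - p'‖² ≤ (L_f²/θ²)‖x - x'‖²`. -/
theorem stmt0 {M r : ℕ} (f : EuclideanSpace ℝ (Fin M) → ℝ)
    (f' : EuclideanSpace ℝ (Fin M) → EuclideanSpace ℝ (Fin M))
    (hgrad : ∀ x, HasGradientAt f (f' x) x)
    (Lf : ℝ) (hlip : ∀ x y, ‖f' x - f' y‖ ≤ Lf * ‖x - y‖)
    (A : Matrix (Fin r) (Fin M) ℝ) (θ : ℝ) (hθ : 0 < θ)
    (hA : ∀ u ∈ LinearMap.range (Matrix.toEuclideanLin A), θ * ‖u‖ ≤ ‖matVec Aᵀ u‖)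
    (x x' : EuclideanSpace ℝ (Fin M)) (p p' : EuclideanSpace ℝ (Fin r))
    (hp : matVec Aᵀ p = -f' x) (hp' : matVec Aᵀ p' = -f' x')
    (hpp : p - p' ∈ LinearMap.range (Matrix.toEuclideanLin A)) :
    ‖p - p'‖ ≤ Lf / θ * ‖x - x'‖ ∧ ‖p - p'‖ ^ 2 ≤ Lf ^ 2 / θ ^ 2 * ‖x - x'‖ ^ 2 := by
  have hsub : matVec Aᵀ (p - p') = f' x' - f' x := by
    have h : matVec Aᵀ (p - p') = matVec Aᵀ p - matVec Aᵀ p' := map_sub _ p p'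
    rw [h, hp, hp']
    abel
  have hbound : ‖p - p'‖ ≤ Lf / θ * ‖x - x'‖ := by
    rw [div_mul_eq_mul_div, le_div_iff₀ hθ, mul_comm]
    calc θ * ‖p - p'‖ ≤ ‖matVec Aᵀ (p - p')‖ := hA _ hpp
      _ = ‖f' x - f' x'‖ := by rw [hsub, norm_sub_rev]
      _ ≤ Lf * ‖x - x'‖ := hlip x x'
  refine ⟨hbound, ?_⟩
  rw [← div_pow, ← mul_pow]
  gcongr
end

section
/- Let f : ℝ^M → ℝ be differentiable, A a real r×M matrix, B a real r×N matrix, c ∈ ℝ^r, α > 0, p ∈ ℝ^r and y⁺ ∈ ℝ^N. If x⁺ is a minimizer over ℝ^M of the function x ↦ f(x) + ⟨p, Ax⟩ + (α/2)‖Ax + By⁺ − c‖₂², and p⁺ := p + α(Ax⁺ + By⁺ − c), then ∇f(x⁺) = −Aᵀp⁺. -/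
open Matrix Filter Topology RealInnerProductSpace

theorem inner_matVec_transpose {r n : ℕ} (A : Matrix (Fin r) (Fin n) ℝ)
    (y : EuclideanSpace ℝ (Fin r)) (x : EuclideanSpace ℝ (Fin n)) :
    ⟪matVec Aᵀ y, x⟫ = ⟪y, matVec A x⟫ := by
  unfold matVec
  rw [← Matrix.conjTranspose_eq_transpose_of_trivial, Matrix.toEuclideanLin_conjTranspose_eq_adjoint,
    LinearMap.adjoint_inner_left]

theorem hasFDerivAt_matVec {r n : ℕ} (A : Matrix (Fin r) (Fin n) ℝ)
    (x : EuclideanSpace ℝ (Fin n)) :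
    HasFDerivAt (matVec A) (LinearMap.toContinuousLinearMap (Matrix.toEuclideanLin A)) x :=
  (LinearMap.toContinuousLinearMap (Matrix.toEuclideanLin A)).hasFDerivAt

/-- If `x⁺` minimizes `x ↦ f(x) + ⟨p, Ax⟩ + (α/2)‖Ax + By⁺ - c‖²` and
`p⁺ = p + α(Ax⁺ + By⁺ - c)`, then `∇f(x⁺) = -Aᵀp⁺`. -/
theorem stmt1 {M N r : ℕ} (f : EuclideanSpace ℝ (Fin M) → ℝ)
    (f' : EuclideanSpace ℝ (Fin M) → EuclideanSpace ℝ (Fin M))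
    (hgrad : ∀ x, HasGradientAt f (f' x) x)
    (A : Matrix (Fin r) (Fin M) ℝ) (B : Matrix (Fin r) (Fin N) ℝ)
    (c : EuclideanSpace ℝ (Fin r)) (α : ℝ) (hα : 0 < α)
    (p : EuclideanSpace ℝ (Fin r)) (yplus : EuclideanSpace ℝ (Fin N))
    (xplus : EuclideanSpace ℝ (Fin M))
    (hmin : ∀ x : EuclideanSpace ℝ (Fin M),
      f xplus + ⟪p, matVec A xplus⟫ + α / 2 * ‖matVec A xplus + matVec B yplus - c‖ ^ 2 ≤
      f x + ⟪p, matVec A x⟫ + α / 2 * ‖matVec A x + matVec B yplus - c‖ ^ 2) :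
    f' xplus = -(matVec Aᵀ (p + α • (matVec A xplus + matVec B yplus - c))) := by
  have hA := hasFDerivAt_matVec A xplus
  have hd := ((hgrad xplus).hasFDerivAt.add ((hasFDerivAt_const p xplus).inner ℝ hA)).add
    (((hA.add_const (matVec B yplus)).sub_const c).norm_sq.const_mul (α / 2))
  have hloc : IsLocalMin (fun x => f x + ⟪p, matVec A x⟫ +
      α / 2 * ‖matVec A x + matVec B yplus - c‖ ^ 2) xplus := Eventually.of_forall hmin
  have h0 := hloc.hasFDerivAt_eq_zero hd
  refine ext_inner_right ℝ fun v => ?_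
  have hv := DFunLike.congr_fun h0 v
  have hmv : Matrix.toEuclideanLin A v = matVec A v := rfl
  simp [fderivInnerCLM_apply, hmv] at hv
  rw [inner_neg_left, inner_matVec_transpose, inner_add_left, real_inner_smul_left,
    inner_sub_left, inner_add_left]
  linarith
end

section
/- Let h : ℝ → ℝ be convex, w ∈ ℝ^N with wᵢ > 0 for all i, B a real r×N matrix, a ∈ ℝ^r, p ∈ ℝ^r, y⁰ ∈ ℝ^N, and α, ρ > 0. Define Φ(y) = Σ_{i=1}^N wᵢ h(yᵢ) + ⟨p, a + By⟩ + (α/2)‖a + By‖₂². If y⁺ is a minimizer over ℝ^N of y ↦ Σ_{i=1}^N wᵢ h(yᵢ) + ⟨p + α(a + By⁰), By⟩ + (ρ/2)‖y − y⁰‖₂², then Φ(y⁺) + ((ρ − α‖B‖²)/2)‖y⁺ − y⁰‖₂² ≤ Φ(y⁰), where ‖B‖ is the operator 2-norm of B. -/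
open Matrix Filter Topology RealInnerProductSpace

/-- The operator 2-norm of a matrix. -/
noncomputable def opNorm2 {r n : ℕ} (A : Matrix (Fin r) (Fin n) ℝ) : ℝ :=
  ‖LinearMap.toContinuousLinearMap (Matrix.toEuclideanLin A)‖

theorem matVec_sub {r n : ℕ} (A : Matrix (Fin r) (Fin n) ℝ) (x y : EuclideanSpace ℝ (Fin n)) :
    matVec A (x - y) = matVec A x - matVec A y :=
  map_sub _ x y

theorem norm_matVec_le {r n : ℕ} (A : Matrix (Fin r) (Fin n) ℝ) (x : EuclideanSpace ℝ (Fin n)) :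
    ‖matVec A x‖ ≤ opNorm2 A * ‖x‖ :=
  (LinearMap.toContinuousLinearMap (Matrix.toEuclideanLin A)).le_opNorm x

/-- Descent of the linearized `y`-subproblem: if `y⁺` minimizes
`y ↦ Σᵢ wᵢ h(yᵢ) + ⟨p + α(a + By⁰), By⟩ + (ρ/2)‖y - y⁰‖²`, then for
`Φ(y) = Σᵢ wᵢ h(yᵢ) + ⟨p, a + By⟩ + (α/2)‖a + By‖²` one has
`Φ(y⁺) + ((ρ - α‖B‖²)/2)‖y⁺ - y⁰‖² ≤ Φ(y⁰)`. -/
theorem stmt2 {N r : ℕ} (h : ℝ → ℝ) (hconv : ConvexOn ℝ Set.univ h)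
    (w : Fin N → ℝ) (hw : ∀ i, 0 < w i)
    (B : Matrix (Fin r) (Fin N) ℝ) (a p : EuclideanSpace ℝ (Fin r))
    (y0 : EuclideanSpace ℝ (Fin N)) (α ρ : ℝ) (hα : 0 < α) (hρ : 0 < ρ)
    (yplus : EuclideanSpace ℝ (Fin N))
    (hmin : ∀ y : EuclideanSpace ℝ (Fin N),
      (∑ i, w i * h (yplus i)) + ⟪p + α • (a + matVec B y0), matVec B yplus⟫ +
          ρ / 2 * ‖yplus - y0‖ ^ 2 ≤
        (∑ i, w i * h (y i)) + ⟪p + α • (a + matVec B y0), matVec B y⟫ +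
          ρ / 2 * ‖y - y0‖ ^ 2) :
    ((∑ i, w i * h (yplus i)) + ⟪p, a + matVec B yplus⟫ + α / 2 * ‖a + matVec B yplus‖ ^ 2) +
        (ρ - α * opNorm2 B ^ 2) / 2 * ‖yplus - y0‖ ^ 2 ≤
      (∑ i, w i * h (y0 i)) + ⟪p, a + matVec B y0⟫ + α / 2 * ‖a + matVec B y0‖ ^ 2 := by
  have hB : ‖matVec B yplus - matVec B y0‖ ^ 2 ≤ opNorm2 B ^ 2 * ‖yplus - y0‖ ^ 2 := by
    rw [← matVec_sub, ← mul_pow]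
    exact pow_le_pow_left₀ (norm_nonneg _) (norm_matVec_le B _) 2
  have hexp : ‖a + matVec B yplus‖ ^ 2 = ‖a + matVec B y0‖ ^ 2 +
      2 * ⟪a + matVec B y0, matVec B yplus - matVec B y0⟫ +
      ‖matVec B yplus - matVec B y0‖ ^ 2 := by
    rw [← norm_add_sq_real]
    congr 2
    abel
  have hle := hmin y0
  simp only [sub_self, norm_zero, inner_add_left, real_inner_smul_left] at hle
  rw [hexp]
  simp only [inner_add_left, inner_add_right, inner_sub_right]
  linear_combination hle + α / 2 * hB
end

section
/- Let f : ℝ^M → ℝ be differentiable, g, h : ℝ → ℝ, A a real r×M matrix, B a real r×N matrix, c ∈ ℝ^r, and α, σ₀, θ > 0. If (x, y, p) ∈ ℝ^M × ℝ^N × ℝ^r satisfies ‖p‖₂ ≤ (1/θ)‖∇f(x)‖₂, then L_α(x,y,p) ≥ (f(x) − σ₀‖∇f(x)‖₂²) + Σ_{i=1}^N g(h(yᵢ)) + (σ₀θ² − 1/(2α))‖p‖₂² + (α/2)‖Ax + By − c + p/α‖₂². -/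
open Matrix Filter Topology RealInnerProductSpace

/-- The augmented Lagrangian `L_α(x,y,p)`. -/
noncomputable def Lag {M N r : ℕ} (f : EuclideanSpace ℝ (Fin M) → ℝ) (g h : ℝ → ℝ)
    (A : Matrix (Fin r) (Fin M) ℝ) (B : Matrix (Fin r) (Fin N) ℝ)
    (c : EuclideanSpace ℝ (Fin r)) (α : ℝ) (x : EuclideanSpace ℝ (Fin M))
    (y : EuclideanSpace ℝ (Fin N)) (p : EuclideanSpace ℝ (Fin r)) : ℝ :=
  f x + (∑ i, g (h (y i))) + ⟪p, matVec A x + matVec B y - c⟫ +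
    α / 2 * ‖matVec A x + matVec B y - c‖ ^ 2

/-- Completing the square for a linear term plus a scaled squared norm. -/
theorem inner_add_half_mul_norm_sq {E : Type*} [NormedAddCommGroup E] [InnerProductSpace ℝ E]
    {a : ℝ} (ha : a ≠ 0) (p u : E) :
    inner ℝ p u + a / 2 * ‖u‖ ^ 2 = a / 2 * ‖u + a⁻¹ • p‖ ^ 2 - 1 / (2 * a) * ‖p‖ ^ 2 := by
  rw [norm_add_sq_real, norm_smul, mul_pow, Real.norm_eq_abs, sq_abs, real_inner_smul_right,
    real_inner_comm u p]
  field_simp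
  ring

/-- If `‖p‖ ≤ (1/θ)‖∇f(x)‖`, then
`L_α(x,y,p) ≥ (f(x) - σ₀‖∇f(x)‖²) + Σᵢ g(h(yᵢ)) + (σ₀θ² - 1/(2α))‖p‖²
  + (α/2)‖Ax + By - c + p/α‖²`. -/
theorem stmt6 {M N r : ℕ} (f : EuclideanSpace ℝ (Fin M) → ℝ)
    (f' : EuclideanSpace ℝ (Fin M) → EuclideanSpace ℝ (Fin M))
    (hgrad : ∀ x, HasGradientAt f (f' x) x)
    (g h : ℝ → ℝ)
    (A : Matrix (Fin r) (Fin M) ℝ) (B : Matrix (Fin r) (Fin N) ℝ)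
    (c : EuclideanSpace ℝ (Fin r)) (α σ₀ θ : ℝ)
    (hα : 0 < α) (hσ₀ : 0 < σ₀) (hθ : 0 < θ)
    (x : EuclideanSpace ℝ (Fin M)) (y : EuclideanSpace ℝ (Fin N))
    (p : EuclideanSpace ℝ (Fin r))
    (hp : ‖p‖ ≤ 1 / θ * ‖f' x‖) :
    Lag f g h A B c α x y p ≥
      (f x - σ₀ * ‖f' x‖ ^ 2) + (∑ i, g (h (y i))) +
        (σ₀ * θ ^ 2 - 1 / (2 * α)) * ‖p‖ ^ 2 +
        α / 2 * ‖matVec A x + matVec B y - c + α⁻¹ • p‖ ^ 2 := by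
  have hgp : θ * ‖p‖ ≤ ‖f' x‖ := by
    rwa [one_div, le_inv_mul_iff₀ hθ] at hp
  have hsq : σ₀ * (θ * ‖p‖) ^ 2 ≤ σ₀ * ‖f' x‖ ^ 2 := by gcongr
  have hcs := inner_add_half_mul_norm_sq hα.ne' p (matVec A x + matVec B y - c)
  unfold Lag
  linarith
end

section
/- Under the hypotheses of the preceding boundedness setting (assumptions on f, g, h; θ > 0 with ‖Aᵀu‖₂ ≥ θ‖u‖₂ on the column space of A; η = L_f²/θ²; column space of B and c contained in column space of A; α > max{1, 2η/δ}; ρ > α‖B‖²; σ₀ > 0 with inf_x (f(x) − σ₀‖∇f(x)‖₂²) > −∞ and α ≥ 1/(2σ₀θ²); p⁰ in the column space of A), suppose in addition that one of the following holds: (B1) y ↦ Σ_{i=1}^N g(h(yᵢ)) is coercive and x ↦ f(x) − σ₀‖∇f(x)‖₂² is coercive; or (B2) y ↦ Σ_{i=1}^N g(h(yᵢ)) is coercive and A is injective. Then the sequence {(x^k, y^k, p^k)}_{k≥1} generated by ILR-ADMM is bounded. -/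
open Matrix Filter Topology RealInnerProductSpace

/-- The ILR-ADMM scheme: `y^{k+1}` minimizes the linearized reweighted `y`-subproblem,
`x^{k+1}` minimizes the `x`-subproblem, and `p^{k+1} = p^k + α(Ax^{k+1} + By^{k+1} - c)`. -/
def ILRADMM {M N r : ℕ} (f : EuclideanSpace ℝ (Fin M) → ℝ) (g h : ℝ → ℝ)
    (A : Matrix (Fin r) (Fin M) ℝ) (B : Matrix (Fin r) (Fin N) ℝ)
    (c : EuclideanSpace ℝ (Fin r)) (α ρ : ℝ)
    (x : ℕ → EuclideanSpace ℝ (Fin M)) (y : ℕ → EuclideanSpace ℝ (Fin N))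
    (p : ℕ → EuclideanSpace ℝ (Fin r)) : Prop :=
  (∀ k, ∀ z : EuclideanSpace ℝ (Fin N),
      (∑ i, deriv g (h (y k i)) * h (y (k + 1) i)) +
          ⟪p k + α • (matVec A (x k) + matVec B (y k) - c), matVec B (y (k + 1))⟫ +
          ρ / 2 * ‖y (k + 1) - y k‖ ^ 2 ≤
        (∑ i, deriv g (h (y k i)) * h (z i)) +
          ⟪p k + α • (matVec A (x k) + matVec B (y k) - c), matVec B z⟫ +
          ρ / 2 * ‖z - y k‖ ^ 2) ∧
    (∀ k, ∀ w : EuclideanSpace ℝ (Fin M),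
      f (x (k + 1)) + ⟪p k, matVec A (x (k + 1))⟫ +
          α / 2 * ‖matVec A (x (k + 1)) + matVec B (y (k + 1)) - c‖ ^ 2 ≤
        f w + ⟪p k, matVec A w⟫ + α / 2 * ‖matVec A w + matVec B (y (k + 1)) - c‖ ^ 2) ∧
    (∀ k, p (k + 1) = p k + α • (matVec A (x (k + 1)) + matVec B (y (k + 1)) - c))

/-- A function on a normed space is coercive if `F(v) → +∞` as `‖v‖ → ∞`. -/
def Coercive {E : Type*} [NormedAddCommGroup E] (F : E → ℝ) : Prop :=
  ∀ C : ℝ, ∃ R : ℝ, ∀ v : E, R ≤ ‖v‖ → C ≤ F v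

/-! ### Coercive functions -/

theorem Coercive.exists_norm_le {E : Type*} [NormedAddCommGroup E] {F : E → ℝ}
    (hF : Coercive F) (C : ℝ) : ∃ R : ℝ, ∀ v, F v ≤ C → ‖v‖ ≤ R := by
  obtain ⟨R, hR⟩ := hF (C + 1)
  refine ⟨R, fun v hv => ?_⟩
  by_contra! hlt
  linarith [hR v hlt.le]

theorem Coercive.bddBelow_range {E : Type*} [NormedAddCommGroup E] [ProperSpace E] {F : E → ℝ}
    (hF : Coercive F) (hcont : Continuous F) : BddBelow (Set.range F) := by
  obtain ⟨R, hR⟩ := hF 0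
  obtain ⟨m, hm⟩ := (isCompact_closedBall (0 : E) R).bddBelow_image hcont.continuousOn
  refine ⟨min m 0, ?_⟩
  rintro _ ⟨v, rfl⟩
  rcases le_total R ‖v‖ with hv | hv
  · exact (min_le_right _ _).trans (hR v hv)
  · exact (min_le_left _ _).trans (hm ⟨v, by simpa using hv, rfl⟩)

/-! ### Convex analysis -/

theorem ConcaveOn.le_add_deriv_mul_sub {g : ℝ → ℝ} (hg : ConcaveOn ℝ Set.univ g)
    (hd : Differentiable ℝ g) (s t : ℝ) : g t ≤ g s + deriv g s * (t - s) := by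
  rcases lt_trichotomy s t with hst | rfl | hst
  · have := hg.slope_le_deriv (Set.mem_univ s) (Set.mem_univ t) hst (hd s)
    rw [slope_def_field, div_le_iff₀ (sub_pos.2 hst)] at this
    linarith
  · simp
  · have := hg.deriv_le_slope (Set.mem_univ t) (Set.mem_univ s) hst (hd s)
    rw [slope_def_field, le_div_iff₀ (sub_pos.2 hst)] at this
    linarith

/-- A strongly convex function grows quadratically away from a minimizer. -/
theorem StrongConvexOn.add_sq_norm_sub_le {E : Type*} [NormedAddCommGroup E] [NormedSpace ℝ E]
    {m : ℝ} {φ : E → ℝ} (hφ : StrongConvexOn Set.univ m φ) {u : E} (hu : ∀ w, φ u ≤ φ w) (w : E) :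
    φ u + m / 2 * ‖u - w‖ ^ 2 ≤ φ w := by
  have key : ∀ t ∈ Set.Ioo (0 : ℝ) 1, (1 - t) * (m / 2 * ‖u - w‖ ^ 2) ≤ φ w - φ u := by
    rintro t ⟨ht0, ht1⟩
    have hc := hφ.2 (Set.mem_univ u) (Set.mem_univ w) (sub_nonneg.2 ht1.le) ht0.le
      (sub_add_cancel 1 t)
    have hmin := hu ((1 - t) • u + t • w)
    simp only [smul_eq_mul] at hc
    refine le_of_mul_le_mul_left ?_ ht0
    linarith
  have hlim : Tendsto (fun t : ℝ => (1 - t) * (m / 2 * ‖u - w‖ ^ 2)) (𝓝[>] 0)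
      (𝓝 (m / 2 * ‖u - w‖ ^ 2)) := by
    have : Continuous fun t : ℝ => (1 - t) * (m / 2 * ‖u - w‖ ^ 2) := by fun_prop
    simpa using (this.tendsto 0).mono_left nhdsWithin_le_nhds
  have := le_of_tendsto hlim <| by
    filter_upwards [Ioo_mem_nhdsGT (zero_lt_one' ℝ)] with t ht using key t ht
  linarith

section PenalizedProblem

variable {E F : Type*} [NormedAddCommGroup E] [InnerProductSpace ℝ E]
  [NormedAddCommGroup F] [InnerProductSpace ℝ F]

theorem strongConvexOn_penalized {f : E → ℝ} {a : E →L[ℝ] F} {δ α : ℝ}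
    (hf : ConvexOn ℝ Set.univ fun x => f x + ‖a x‖ ^ 2 / 2 - δ / 2 * ‖x‖ ^ 2) (hα : 1 ≤ α)
    (p d : F) :
    StrongConvexOn Set.univ δ fun w => f w + ⟪p, a w⟫ + α / 2 * ‖a w + d‖ ^ 2 := by
  rw [strongConvexOn_iff_convex]
  have hsq : ConvexOn ℝ Set.univ fun w => (α - 1) / 2 * ‖a w‖ ^ 2 := by
    have h1 : ConvexOn ℝ Set.univ fun v : F => ‖v‖ ^ 2 :=
      convexOn_univ_norm.pow (fun _ _ => norm_nonneg _) 2
    have h2 := (h1.comp_linearMap a.toLinearMap).smul (c := (α - 1) / 2) (by linarith)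
    simpa using! h2
  have hlin : ConvexOn ℝ Set.univ fun w => ⟪p + α • d, a w⟫ + α / 2 * ‖d‖ ^ 2 :=
    (((innerSL ℝ (p + α • d)).comp a).toLinearMap.convexOn convex_univ).add_const _
  refine ((hf.add hsq).add hlin).congr fun w _ => ?_
  simp only [Pi.add_apply, norm_add_sq_real, inner_add_left, real_inner_smul_left,
    real_inner_comm d (a w)]
  ring

theorem gradient_eq_neg_adjoint_of_isMin_penalized [CompleteSpace E] [CompleteSpace F]
    {f : E → ℝ} {a : E →L[ℝ] F} {α : ℝ} {p d : F} {u v : E} (hgrad : HasGradientAt f v u)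
    (hmin : ∀ w, f u + ⟪p, a u⟫ + α / 2 * ‖a u + d‖ ^ 2 ≤
      f w + ⟪p, a w⟫ + α / 2 * ‖a w + d‖ ^ 2) :
    v = -(ContinuousLinearMap.adjoint a (p + α • (a u + d))) := by
  have h1 : HasFDerivAt (fun w => ⟪p, a w⟫) ((innerSL ℝ p).comp a) u :=
    ((innerSL ℝ p).comp a).hasFDerivAt
  have h2 := ((a.hasFDerivAt (x := u)).add_const d).norm_sq.const_mul (α / 2)
  have h3 := (hgrad.hasFDerivAt.add h1).add h2
  have h4 := IsLocalMin.hasFDerivAt_eq_zero (Eventually.of_forall hmin) h3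
  rw [eq_neg_iff_add_eq_zero]
  refine ext_inner_right ℝ fun w => ?_
  have h5 := DFunLike.congr_fun h4 w
  simp only [map_add, ContinuousLinearMap.add_comp, smul_add, _root_.add_apply,
    InnerProductSpace.toDual_apply_apply, ContinuousLinearMap.comp_apply, coe_innerSL_apply,
    _root_.smul_apply, nsmul_eq_mul, Nat.cast_ofNat, smul_eq_mul, _root_.zero_apply] at h5
  rw [inner_add_left, ContinuousLinearMap.adjoint_inner_left, inner_add_left,
    real_inner_smul_left, inner_add_left, inner_zero_left]
  linarith

end PenalizedProblem

/-- boundedness of the iterates. Under the hypotheses of the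
boundedness setting, if moreover (B1) both `y ↦ Σᵢ g(h(yᵢ))` and
`x ↦ f(x) - σ₀‖∇f(x)‖²` are coercive, or (B2) `y ↦ Σᵢ g(h(yᵢ))` is coercive and `A`
is injective, then the sequence `{(x^k, y^k, p^k)}_{k ≥ 1}` is bounded. -/
theorem stmt8 {M N r : ℕ} (f : EuclideanSpace ℝ (Fin M) → ℝ)
    (f' : EuclideanSpace ℝ (Fin M) → EuclideanSpace ℝ (Fin M))
    (hgrad : ∀ x, HasGradientAt f (f' x) x)
    (hfconv : ConvexOn ℝ Set.univ f)
    (Lf : ℝ) (hlip : ∀ x y, ‖f' x - f' y‖ ≤ Lf * ‖x - y‖)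
    (A : Matrix (Fin r) (Fin M) ℝ) (B : Matrix (Fin r) (Fin N) ℝ)
    (c : EuclideanSpace ℝ (Fin r))
    (δ : ℝ) (hδ : 0 < δ)
    (hstrong : ConvexOn ℝ Set.univ
      (fun x : EuclideanSpace ℝ (Fin M) =>
        f x + ‖matVec A x‖ ^ 2 / 2 - δ / 2 * ‖x‖ ^ 2))
    (h : ℝ → ℝ) (hconv : ConvexOn ℝ Set.univ h)
    (g : ℝ → ℝ) (hg : Differentiable ℝ g) (hgc : ConcaveOn ℝ Set.univ g)
    (Lg : ℝ) (hgl : ∀ s t, |deriv g s - deriv g t| ≤ Lg * |s - t|)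
    (hgpos : ∀ t ∈ Set.range h, 0 < deriv g t)
    (θ : ℝ) (hθ : 0 < θ)
    (hA : ∀ u ∈ LinearMap.range (Matrix.toEuclideanLin A), θ * ‖u‖ ≤ ‖matVec Aᵀ u‖)
    (η : ℝ) (hη : η = Lf ^ 2 / θ ^ 2)
    (hrange : LinearMap.range (Matrix.toEuclideanLin B) ≤
      LinearMap.range (Matrix.toEuclideanLin A))
    (hc : c ∈ LinearMap.range (Matrix.toEuclideanLin A))
    (α ρ : ℝ) (hα : α > max 1 (2 * η / δ)) (hρ : ρ > α * opNorm2 B ^ 2)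
    (σ₀ : ℝ) (hσ₀ : 0 < σ₀)
    (hinf : BddBelow (Set.range fun x : EuclideanSpace ℝ (Fin M) =>
      f x - σ₀ * ‖f' x‖ ^ 2))
    (hασ : α ≥ 1 / (2 * σ₀ * θ ^ 2))
    (x : ℕ → EuclideanSpace ℝ (Fin M)) (y : ℕ → EuclideanSpace ℝ (Fin N))
    (p : ℕ → EuclideanSpace ℝ (Fin r))
    (hscheme : ILRADMM f g h A B c α ρ x y p)
    (hp0 : p 0 ∈ LinearMap.range (Matrix.toEuclideanLin A))
    (hB1B2 :
      (Coercive (fun y : EuclideanSpace ℝ (Fin N) => ∑ i, g (h (y i))) ∧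
        Coercive (fun x : EuclideanSpace ℝ (Fin M) => f x - σ₀ * ‖f' x‖ ^ 2)) ∨
      (Coercive (fun y : EuclideanSpace ℝ (Fin N) => ∑ i, g (h (y i))) ∧
        Function.Injective (fun u => matVec A u))) :
    ∃ C : ℝ, ∀ k, 1 ≤ k → ‖x k‖ ≤ C ∧ ‖y k‖ ≤ C ∧ ‖p k‖ ≤ C := by
  obtain ⟨hy, hx, hp⟩ := hscheme
  set a := LinearMap.toContinuousLinearMap (Matrix.toEuclideanLin A)
  set b := LinearMap.toContinuousLinearMap (Matrix.toEuclideanLin B)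
  have hAa : ∀ u, matVec A u = a u := fun _ => rfl
  have hBb : ∀ u, matVec B u = b u := fun _ => rfl
  have hAt : ∀ u, matVec Aᵀ u = ContinuousLinearMap.adjoint a u := fun u => by
    have := Matrix.toEuclideanLin_conjTranspose_eq_adjoint A
    rw [Matrix.conjTranspose_eq_transpose_of_trivial] at this
    rw [matVec, this]
    rfl
  have hBn : opNorm2 B = ‖b‖ := rfl
  simp only [hAa, hBb] at hy hx hp hstrong hB1B2
  simp only [hAt] at hA
  rw [hBn] at hρ
  have hα1 : 1 < α := (le_max_left _ _).trans_lt hα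
  have hα0 : 0 < α := by linarith
  have hηα : η / α < δ / 2 := by
    have := (le_max_right _ _).trans_lt hα
    rw [div_lt_iff₀ hδ] at this
    rw [div_lt_iff₀ hα0]
    linarith
  have hres : ∀ u v, a u + b v - c ∈ LinearMap.range (Matrix.toEuclideanLin A) := fun u v =>
    sub_mem (add_mem ⟨u, rfl⟩ (hrange ⟨v, rfl⟩)) hc
  have hpr : ∀ k, p k ∈ LinearMap.range (Matrix.toEuclideanLin A) := fun k => by
    induction k with
    | zero => exact hp0
    | succ k ih => rw [hp]; exact add_mem ih (Submodule.smul_mem _ _ (hres _ _))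
  have hopt : ∀ k, f' (x (k + 1)) = -(ContinuousLinearMap.adjoint a (p (k + 1))) := fun k => by
    have := gradient_eq_neg_adjoint_of_isMin_penalized (p := p k) (d := b (y (k + 1)) - c)
      (α := α) (a := a) (hgrad (x (k + 1))) fun w => by simpa only [add_sub_assoc] using hx k w
    rw [this, hp, add_sub_assoc]
  have hpf : ∀ k, θ * ‖p (k + 1)‖ ≤ ‖f' (x (k + 1))‖ := fun k => by
    rw [hopt, norm_neg]; exact hA _ (hpr _)
  have hdp : ∀ k, ‖p (k + 2) - p (k + 1)‖ ^ 2 ≤ η * ‖x (k + 2) - x (k + 1)‖ ^ 2 := fun k => by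
    have h1 := hA _ (sub_mem (hpr (k + 2)) (hpr (k + 1)))
    have h2 := hlip (x (k + 2)) (x (k + 1))
    have h3 : f' (x (k + 2)) - f' (x (k + 1)) =
        -(ContinuousLinearMap.adjoint a (p (k + 2) - p (k + 1))) := by
      rw [hopt, hopt, map_sub]; abel
    rw [h3, norm_neg] at h2
    have h4 := pow_le_pow_left₀ (by positivity) (h1.trans h2) 2
    rw [hη, div_mul_eq_mul_div, le_div_iff₀ (by positivity)]
    linarith
  set L : ℕ → ℝ := fun k => Lag f g h A B c α (x (k + 1)) (y (k + 1)) (p (k + 1)) with hL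
  have hstepy : ∀ k, Lag f g h A B c α (x k) (y (k + 1)) (p k) ≤
      Lag f g h A B c α (x k) (y k) (p k) := fun k => by
    have h1 := hy k (y k)
    have h2 : ∑ i, g (h (y (k + 1) i)) ≤ ∑ i, g (h (y k i)) +
        ∑ i, deriv g (h (y k i)) * h (y (k + 1) i) - ∑ i, deriv g (h (y k i)) * h (y k i) := by
      rw [← Finset.sum_add_distrib, ← Finset.sum_sub_distrib]
      refine Finset.sum_le_sum fun i _ => ?_
      linarith [hgc.le_add_deriv_mul_sub hg (h (y k i)) (h (y (k + 1) i))]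
    have h3 : a (x k) + b (y (k + 1)) - c = (a (x k) + b (y k) - c) + b (y (k + 1) - y k) := by
      rw [map_sub]; abel
    have h4 : α * ‖b (y (k + 1) - y k)‖ ^ 2 ≤ ρ * ‖y (k + 1) - y k‖ ^ 2 := by
      have := pow_le_pow_left₀ (norm_nonneg _) (b.le_opNorm (y (k + 1) - y k)) 2
      calc _ ≤ α * (‖b‖ * ‖y (k + 1) - y k‖) ^ 2 := by gcongr
        _ = (α * ‖b‖ ^ 2) * ‖y (k + 1) - y k‖ ^ 2 := by ring
        _ ≤ _ := by gcongr
    have h5 : ⟪p k + α • (a (x k) + b (y k) - c), b (y (k + 1))⟫ =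
        ⟪p k + α • (a (x k) + b (y k) - c), b (y k)⟫ + ⟪p k, b (y (k + 1) - y k)⟫ +
          α * ⟪a (x k) + b (y k) - c, b (y (k + 1) - y k)⟫ := by
      rw [map_sub, ← real_inner_smul_left, add_assoc, ← inner_add_left, ← inner_add_right,
        add_sub_cancel]
    simp only [Lag, hAa, hBb, h3]
    rw [norm_add_sq_real, inner_add_right]
    simp only [sub_self, norm_zero] at h1
    linarith
  have hstepx : ∀ k, Lag f g h A B c α (x (k + 1)) (y (k + 1)) (p k) +
      δ / 2 * ‖x (k + 1) - x k‖ ^ 2 ≤ Lag f g h A B c α (x k) (y (k + 1)) (p k) := fun k => by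
    have h1 := (strongConvexOn_penalized hstrong hα1.le (p k)
      (b (y (k + 1)) - c)).add_sq_norm_sub_le (u := x (k + 1))
      (fun w => by simpa only [add_sub_assoc] using hx k w) (x k)
    simp only [Lag, hAa, hBb, add_sub_assoc, inner_add_right]
    linarith
  have hstepp : ∀ k, Lag f g h A B c α (x (k + 1)) (y (k + 1)) (p (k + 1)) =
      Lag f g h A B c α (x (k + 1)) (y (k + 1)) (p k) + ‖p (k + 1) - p k‖ ^ 2 / α := fun k => by
    have h1 : p (k + 1) - p k = α • (a (x (k + 1)) + b (y (k + 1)) - c) := by rw [hp]; abel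
    rw [h1, norm_smul, mul_pow, Real.norm_eq_abs, sq_abs]
    have h2 : α ^ 2 * ‖a (x (k + 1)) + b (y (k + 1)) - c‖ ^ 2 / α =
        ⟪α • (a (x (k + 1)) + b (y (k + 1)) - c), a (x (k + 1)) + b (y (k + 1)) - c⟫ := by
      rw [real_inner_smul_left, real_inner_self_eq_norm_sq]
      field_simp
    rw [h2, ← h1, inner_sub_left]
    simp only [Lag, hAa, hBb]
    ring
  have hdesc : ∀ k, (δ / 2 - η / α) * ‖x (k + 2) - x (k + 1)‖ ^ 2 ≤ L k - L (k + 1) :=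
      fun k => by
    have h1 := hstepy (k + 1)
    have h2 := hstepx (k + 1)
    have h3 := hstepp (k + 1)
    have h4 := div_le_div_of_nonneg_right (hdp k) hα0.le
    rw [mul_div_right_comm] at h4
    simp only [hL]
    simp only [add_assoc, Nat.reduceAdd] at h1 h2 h3 ⊢
    linarith
  have hanti : Antitone L := antitone_nat_of_succ_le fun k => by
    have : 0 ≤ (δ / 2 - η / α) * ‖x (k + 2) - x (k + 1)‖ ^ 2 :=
      mul_nonneg (by linarith) (sq_nonneg _)
    linarith [hdesc k]
  have hL0 : ∀ k, L k ≤ L 0 := fun k => hanti (Nat.zero_le k)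
  have hlow : ∀ k, f (x (k + 1)) - σ₀ * ‖f' (x (k + 1))‖ ^ 2 + ∑ i, g (h (y (k + 1) i)) ≤
      L k := fun k => by
    have h1 : ‖p (k + 1)‖ ^ 2 / (2 * α) ≤ σ₀ * ‖f' (x (k + 1))‖ ^ 2 := by
      have h2 := pow_le_pow_left₀ (by positivity) (hpf k) 2
      have h3 : 1 ≤ α * (2 * σ₀ * θ ^ 2) := (div_le_iff₀ (by positivity)).1 hασ
      rw [div_le_iff₀ (by positivity)]
      calc ‖p (k + 1)‖ ^ 2 ≤ (α * (2 * σ₀ * θ ^ 2)) * ‖p (k + 1)‖ ^ 2 :=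
            le_mul_of_one_le_left (sq_nonneg _) h3
        _ = (2 * α * σ₀) * (θ * ‖p (k + 1)‖) ^ 2 := by ring
        _ ≤ (2 * α * σ₀) * ‖f' (x (k + 1))‖ ^ 2 := by gcongr
        _ = _ := by ring
    have h2 : 0 ≤ ‖p (k + 1) + α • (a (x (k + 1)) + b (y (k + 1)) - c)‖ ^ 2 / (2 * α) := by
      positivity
    rw [norm_add_sq_real, norm_smul, mul_pow, Real.norm_eq_abs, sq_abs,
      real_inner_smul_right] at h2
    have h3 : (‖p (k + 1)‖ ^ 2 + 2 * (α * ⟪p (k + 1), a (x (k + 1)) + b (y (k + 1)) - c⟫) +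
        α ^ 2 * ‖a (x (k + 1)) + b (y (k + 1)) - c‖ ^ 2) / (2 * α) =
        ‖p (k + 1)‖ ^ 2 / (2 * α) + ⟪p (k + 1), a (x (k + 1)) + b (y (k + 1)) - c⟫ +
          α / 2 * ‖a (x (k + 1)) + b (y (k + 1)) - c‖ ^ 2 := by
      field_simp
    rw [h3] at h2
    simp only [hL, Lag, hAa, hBb]
    linarith
  have hG : Coercive fun y : EuclideanSpace ℝ (Fin N) => ∑ i, g (h (y i)) :=
    hB1B2.elim And.left And.left
  have hhc : Continuous h := continuousOn_univ.1 (hconv.continuousOn isOpen_univ)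
  have hgcont : Continuous g := hg.continuous
  obtain ⟨mG, hmG⟩ := hG.bddBelow_range (by fun_prop)
  obtain ⟨mf, hmf⟩ := hinf
  have hmG' : ∀ v : EuclideanSpace ℝ (Fin N), mG ≤ ∑ i, g (h (v i)) := fun v => hmG ⟨v, rfl⟩
  have hmf' : ∀ u, mf ≤ f u - σ₀ * ‖f' u‖ ^ 2 := fun u => hmf ⟨u, rfl⟩
  obtain ⟨Ry, hRy⟩ := hG.exists_norm_le (L 0 - mf)
  have hyb : ∀ k, ‖y (k + 1)‖ ≤ Ry := fun k =>
    hRy _ (by linarith [hlow k, hL0 k, hmf' (x (k + 1))])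
  have hxb : ∃ Rx, ∀ k, ‖x (k + 1)‖ ≤ Rx := by
    rcases hB1B2 with ⟨-, hF⟩ | ⟨-, hinj⟩
    · obtain ⟨Rx, hRx⟩ := hF.exists_norm_le (L 0 - mG)
      exact ⟨Rx, fun k => hRx _ (by linarith [hlow k, hL0 k, hmG' (y (k + 1))])⟩
    · obtain ⟨K, -, hK⟩ := LinearMap.exists_antilipschitzWith (Matrix.toEuclideanLin A)
        (LinearMap.ker_eq_bot.2 hinj)
      have hKa : ∀ u, ‖u‖ ≤ K * ‖a u‖ := fun u =>
        ZeroHomClass.bound_of_antilipschitz (Matrix.toEuclideanLin A) hK u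
      set D := η * ((L 0 - (mf + mG)) / (δ / 2 - η / α))
      have hη0 : 0 ≤ η := by rw [hη]; positivity
      have hdpb : ∀ k, ‖p (k + 2) - p (k + 1)‖ ≤ √D := fun k => by
        refine Real.le_sqrt_of_sq_le ((hdp k).trans (mul_le_mul_of_nonneg_left ?_ hη0))
        rw [le_div_iff₀ (by linarith)]
        linarith [hdesc k, hL0 k, hlow (k + 1), hmf' (x (k + 2)), hmG' (y (k + 2))]
      have hax : ∀ k, ‖a (x (k + 2))‖ ≤ √D + ‖b‖ * Ry + ‖c‖ := fun k => by
        have h1 : p (k + 2) - p (k + 1) = α • (a (x (k + 2)) + b (y (k + 2)) - c) := by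
          rw [hp (k + 1)]; abel
        have h2 := hdpb k
        rw [h1, norm_smul, Real.norm_of_nonneg hα0.le] at h2
        have h3 : ‖a (x (k + 2)) + b (y (k + 2)) - c‖ ≤ √D :=
          (le_mul_of_one_le_left (norm_nonneg _) hα1.le).trans h2
        have h4 : ‖b (y (k + 2))‖ ≤ ‖b‖ * Ry :=
          (b.le_opNorm _).trans (mul_le_mul_of_nonneg_left (hyb (k + 1)) (norm_nonneg _))
        calc ‖a (x (k + 2))‖
            = ‖(a (x (k + 2)) + b (y (k + 2)) - c) - b (y (k + 2)) + c‖ := by congr 1; abel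
          _ ≤ ‖a (x (k + 2)) + b (y (k + 2)) - c‖ + ‖b (y (k + 2))‖ + ‖c‖ :=
            (norm_add_le _ _).trans (by gcongr; exact norm_sub_le _ _)
          _ ≤ _ := by gcongr
      refine ⟨max ‖x 1‖ (K * (√D + ‖b‖ * Ry + ‖c‖)), fun k => ?_⟩
      rcases k with _ | k
      · exact le_max_left _ _
      · exact le_max_of_le_right ((hKa _).trans (by gcongr; exact hax k))
  obtain ⟨Rx, hRx⟩ := hxb
  have hpb : ∀ k, ‖p (k + 1)‖ ≤ (‖f' 0‖ + |Lf| * Rx) / θ := fun k => by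
    rw [le_div_iff₀ hθ]
    have h1 : ‖f' (x (k + 1)) - f' 0‖ ≤ |Lf| * Rx := by
      refine (hlip _ _).trans ?_
      rw [sub_zero]
      exact mul_le_mul (le_abs_self _) (hRx k) (norm_nonneg _) (abs_nonneg _)
    linarith [hpf k, norm_le_norm_add_norm_sub' (f' (x (k + 1))) (f' 0)]
  refine ⟨max Rx (max Ry ((‖f' 0‖ + |Lf| * Rx) / θ)), fun k hk => ?_⟩
  obtain ⟨k, rfl⟩ := Nat.exists_eq_add_of_le' hk
  exact ⟨le_max_of_le_left (hRx k), le_max_of_le_right (le_max_of_le_left (hyb k)),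
    le_max_of_le_right (le_max_of_le_right (hpb k))⟩
end

section
/- Let η̂ > 0 and let φ : [0, η̂) → ℝ be continuous and concave with φ(0) = 0, differentiable on (0, η̂) with φ'(s) > 0 for all s ∈ (0, η̂). Let a*, a, b ∈ ℝ and ν, τ > 0 and s ≥ 0 satisfy: 0 < a − a* < η̂, 0 ≤ b − a* < η̂, a − b ≥ ν s², and φ'(a − a*)·τ·s ≥ 1. Then (ν/τ)·s ≤ φ(a − a*) − φ(b − a*). -/
open Filter Topology

/-- A concave function lies below its tangent line at a point `y`, to the left of `y`. -/
theorem ConcaveOn.mul_sub_le_sub_of_hasDerivAt {S : Set ℝ} {f : ℝ → ℝ} {x y f' : ℝ}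
    (hf : ConcaveOn ℝ S f) (hx : x ∈ S) (hy : y ∈ S) (hxy : x < y) (hd : HasDerivAt f f' y) :
    f' * (y - x) ≤ f y - f x := by
  have h := hf.le_slope_of_hasDerivAt hx hy hxy hd
  rwa [slope_def_field, le_div_iff₀ (sub_pos.2 hxy)] at h

/-- one-step Kurdyka–Łojasiewicz estimate. For a continuous concave
desingularizing function `φ` on `[0, η̂)` with `φ(0) = 0` and positive derivative `φ'`
on `(0, η̂)`: if `0 < a - a* < η̂`, `0 ≤ b - a* < η̂`, `a - b ≥ ν s²` and
`φ'(a - a*)·τ·s ≥ 1`, then `(ν/τ)·s ≤ φ(a - a*) - φ(b - a*)`. -/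
theorem stmt14 (ηhat : ℝ) (hηhat : 0 < ηhat) (φ φ' : ℝ → ℝ)
    (hcont : ContinuousOn φ (Set.Ico 0 ηhat))
    (hconc : ConcaveOn ℝ (Set.Ico 0 ηhat) φ)
    (hφ0 : φ 0 = 0)
    (hderiv : ∀ s ∈ Set.Ioo 0 ηhat, HasDerivAt φ (φ' s) s)
    (hpos : ∀ s ∈ Set.Ioo 0 ηhat, 0 < φ' s)
    (astar a b : ℝ) (ν τ s : ℝ) (hν : 0 < ν) (hτ : 0 < τ) (hs : 0 ≤ s)
    (ha1 : 0 < a - astar) (ha2 : a - astar < ηhat)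
    (hb1 : 0 ≤ b - astar) (hb2 : b - astar < ηhat)
    (hdesc : a - b ≥ ν * s ^ 2)
    (hKL : φ' (a - astar) * τ * s ≥ 1) :
    ν / τ * s ≤ φ (a - astar) - φ (b - astar) := by
  have hs0 : 0 < s := by
    refine hs.lt_of_ne fun h => ?_
    rw [← h, mul_zero] at hKL
    linarith
  have hab : b < a := by
    have : 0 < ν * s ^ 2 := by positivity
    linarith
  have hφ' : 0 < φ' (a - astar) := hpos _ ⟨ha1, ha2⟩
  calc ν / τ * s ≤ ν / τ * s * (φ' (a - astar) * τ * s) :=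
        le_mul_of_one_le_right (by positivity) hKL
    _ = φ' (a - astar) * (ν * s ^ 2) := by field_simp
    _ ≤ φ' (a - astar) * ((a - astar) - (b - astar)) := by
        gcongr
        linarith
    _ ≤ φ (a - astar) - φ (b - astar) :=
        hconc.mul_sub_le_sub_of_hasDerivAt ⟨hb1, hb2⟩ ⟨ha1.le, ha2⟩ (by linarith)
          (hderiv _ ⟨ha1, ha2⟩)
end
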